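/- Let η ∈ C²(𝕋^d) satisfy −γ ∂₁η = −G[η](σH(η) + gη) with σ > 0, g ≥ 0, γ ∈ ℝ, where G[η] is the Dirichlet-to-Neumann operator of Ω_η and H the mean curvature operator. If σH(η) + gη lies in H̊^{1/2}(𝕋^d), then ∫_{𝕋^d}(σH(η)+gη) G[η](σH(η)+gη) dx = 0, and hence σH(η) + gη = 0 and η = 0. -/

import Mathlib

open Real

/-- The fundamental cell `[0, 2π]^d` of the torus. -/
def torusBox (d : ℕ) : Set (EuclideanSpace ℝ (Fin d)) :=
  {x | ∀ i, x i ∈ Set.Icc 0 (2 * π)}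

/-- The mean curvature operator `H(η) = -div(∇η/√(1+|∇η|²))`. -/
noncomputable def meanCurv {d : ℕ} (η : EuclideanSpace ℝ (Fin d) → ℝ)
    (x : EuclideanSpace ℝ (Fin d)) : ℝ :=
  -∑ i : Fin d,
    fderiv ℝ (fun y => (Real.sqrt (1 + ‖gradient η y‖ ^ 2))⁻¹ * gradient η y i) x
      (EuclideanSpace.single i 1)

/-- Horizontal partial derivative `∂_{x_i}` of a function on `ℝ^d × ℝ`. -/
noncomputable def pdx {d : ℕ} (i : Fin d) (q : EuclideanSpace ℝ (Fin d) × ℝ → ℝ)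
    (p : EuclideanSpace ℝ (Fin d) × ℝ) : ℝ :=
  fderiv ℝ q p (EuclideanSpace.single i 1, 0)

/-- Vertical partial derivative `∂_z` of a function on `ℝ^d × ℝ`. -/
noncomputable def pdz {d : ℕ} (q : EuclideanSpace ℝ (Fin d) × ℝ → ℝ)
    (p : EuclideanSpace ℝ (Fin d) × ℝ) : ℝ :=
  fderiv ℝ q p (0, 1)


open MeasureTheory

lemma torusBox_eq (d : ℕ) : torusBox d =
    (WithLp.ofLp : EuclideanSpace ℝ (Fin d) → (Fin d → ℝ)) ⁻¹'
      (Set.Icc (fun _ => 0) (fun _ => 2 * π)) := by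
  ext x
  simp only [torusBox, Set.mem_ofPred_eq, Set.mem_preimage, Set.mem_Icc, Pi.le_def, forall_and]

lemma torusBox_isCompact (d : ℕ) : IsCompact (torusBox d) := by
  rw [torusBox_eq]
  exact (EuclideanSpace.equiv (Fin d) ℝ).toHomeomorph.isCompact_preimage.2 isCompact_Icc

lemma torusBox_integral (d : ℕ) (f : EuclideanSpace ℝ (Fin d) → ℝ) :
    ∫ x in torusBox d, f x =
      ∫ y in Set.Icc (fun _ : Fin d => (0 : ℝ)) (fun _ => 2 * π), f (WithLp.toLp 2 y) := by
  have h := (PiLp.volume_preserving_toLp (Fin d)).setIntegral_preimage_emb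
    (MeasurableEquiv.toLp 2 (Fin d → ℝ)).measurableEmbedding f (torusBox d)
  rw [← h, torusBox_eq]
  rfl

lemma torusBox_integrableOn {d : ℕ} {f : EuclideanSpace ℝ (Fin d) → ℝ} (hf : Continuous f) :
    IntegrableOn f (torusBox d) :=
  hf.continuousOn.integrableOn_compact (torusBox_isCompact d)

lemma integral_partial {d : ℕ} (F : EuclideanSpace ℝ (Fin d) → ℝ) (hF : ContDiff ℝ 1 F)
    (i : Fin d) (hper : ∀ x : EuclideanSpace ℝ (Fin d),
      F (x + (2 * π) • EuclideanSpace.single i 1) = F x) :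
    ∫ x in torusBox d, fderiv ℝ F x (EuclideanSpace.single i 1) = 0 := by
  obtain _ | n := d
  · exact i.elim0
  rw [torusBox_integral]
  set e := (PiLp.continuousLinearEquiv 2 ℝ (fun _ : Fin (n+1) => ℝ)).symm with he
  have hcont : Continuous fun y : Fin (n+1) → ℝ =>
      fderiv ℝ F (WithLp.toLp 2 y) (EuclideanSpace.single i 1) :=
    ((hF.continuous_fderiv (by norm_num)).comp e.continuous).clm_apply continuous_const
  have hsum : ∀ y : Fin (n+1) → ℝ,
      ∑ j, (if j = i then (fderiv ℝ F (e y)).comp (e : (Fin (n+1) → ℝ) →L[ℝ] _) else 0)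
        (Pi.single j 1) = fderiv ℝ F (WithLp.toLp 2 y) (EuclideanSpace.single i 1) := by
    intro y
    rw [Finset.sum_eq_single i]
    · simp only [if_true]
      rfl
    · intro j _ hj; simp [hj]
    · simp
  have hdiv := integral_divergence_of_hasFDerivAt_off_countable'
    (fun _ : Fin (n+1) => (0 : ℝ)) (fun _ => 2 * π)
    (fun _ => by positivity)
    (fun j y => if j = i then F (e y) else 0)
    (fun j y => if j = i then (fderiv ℝ F (e y)).comp (e : (Fin (n+1) → ℝ) →L[ℝ] _) else 0)
    ∅ Set.countable_empty
    (by
      intro j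
      by_cases hj : j = i
      · simp only [hj, if_true]
        exact (hF.continuous.comp e.continuous).continuousOn
      · simp only [hj, if_false]
        exact continuousOn_const)
    (by
      intro x _ j
      by_cases hj : j = i
      · simp only [hj, if_true]
        exact ((hF.differentiable (by norm_num)) (e x)).hasFDerivAt.comp x e.hasFDerivAt
      · simp only [hj, if_false]
        exact hasFDerivAt_const _ _)
    (by
      simp only [hsum]
      exact hcont.continuousOn.integrableOn_compact isCompact_Icc)
  simp only [hsum] at hdiv
  rw [hdiv]
  apply Finset.sum_eq_zero
  intro j _
  by_cases hj : j = i
  · subst hj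
    simp only [if_true]
    rw [sub_eq_zero]
    congr 1
    ext y
    rw [← hper (e (j.insertNth 0 y))]
    congr 1
    ext k
    simp only [he]
    refine Fin.succAboveCases j ?_ ?_ k
    · simp
    · intro k; simp
  · simp [hj]

lemma periodic_rep {d : ℕ} (f : EuclideanSpace ℝ (Fin d) → ℝ)
    (hper : ∀ (x : EuclideanSpace ℝ (Fin d)) (i : Fin d),
      f (x + (2 * π) • EuclideanSpace.single i 1) = f x) (x : EuclideanSpace ℝ (Fin d)) :
    ∃ y ∈ torusBox d, f y = f x := by
  have hint : ∀ (x : EuclideanSpace ℝ (Fin d)) (i : Fin d) (n : ℤ),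
      f (x + ((n : ℝ) * (2 * π)) • EuclideanSpace.single i 1) = f x := by
    intro x i n
    have hp : Function.Periodic f ((2 * π) • EuclideanSpace.single i (1:ℝ)) := fun x => hper x i
    have := (hp.zsmul n) x
    rw [← this, mul_smul, Int.cast_smul_eq_zsmul]
  have hfin : ∀ (s : Finset (Fin d)) (n : Fin d → ℤ),
      f (x + ∑ i ∈ s, ((n i : ℝ) * (2 * π)) • EuclideanSpace.single i 1) = f x := by
    intro s n
    induction s using Finset.induction_on with
    | empty => simp
    | insert a s ha ih =>
      rw [Finset.sum_insert ha, add_comm (_ • _), ← add_assoc, hint, ih]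
  refine ⟨_, ?_, hfin Finset.univ (fun i => -⌊x i / (2 * π)⌋)⟩
  intro i
  have hc : (x + ∑ i, (((-⌊x i / (2 * π)⌋ : ℤ) : ℝ) * (2 * π)) •
      (EuclideanSpace.single i 1 : EuclideanSpace ℝ (Fin d))) i =
      x i - ⌊x i / (2 * π)⌋ * (2 * π) := by
    simp [Finset.sum_apply, Pi.single_apply]
    ring
  rw [hc]
  have h2 : (0:ℝ) < 2 * π := by positivity
  have h1 := Int.floor_le (x i / (2 * π))
  have h3 := Int.lt_floor_add_one (x i / (2 * π))
  rw [le_div_iff₀ h2] at h1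
  rw [div_lt_iff₀ h2] at h3
  constructor <;> linarith

lemma torusBox_interior_nonempty (d : ℕ) : (interior (torusBox d)).Nonempty := by
  refine ⟨WithLp.toLp 2 (fun _ => π), ?_⟩
  rw [mem_interior]
  refine ⟨⋂ i, {x | x i ∈ Set.Ioo 0 (2 * π)}, ?_, ?_, ?_⟩
  · intro x hx i
    exact Set.Ioo_subset_Icc_self (Set.mem_iInter.1 hx i)
  · apply isOpen_iInter_of_finite
    intro i
    exact isOpen_Ioo.preimage (by fun_prop)
  · simp [Real.pi_pos]

lemma torusBox_closure (d : ℕ) : torusBox d ⊆ closure (interior (torusBox d)) := by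
  have hc : Convex ℝ (torusBox d) := by
    rw [torusBox_eq]
    exact (convex_Icc _ _).linear_preimage (EuclideanSpace.equiv (Fin d) ℝ).toLinearMap
  rw [hc.closure_interior_eq_closure_of_nonempty_interior (torusBox_interior_nonempty d)]
  exact subset_closure

lemma periodic_zero {d : ℕ} (f : EuclideanSpace ℝ (Fin d) → ℝ) (hf : Continuous f)
    (hper : ∀ (x : EuclideanSpace ℝ (Fin d)) (i : Fin d),
      f (x + (2 * π) • EuclideanSpace.single i 1) = f x)
    (h0 : ∀ x, 0 ≤ f x) (hint : ∫ x in torusBox d, f x = 0) : ∀ x, f x = 0 := by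
  intro x
  obtain ⟨y, hy, hxy⟩ := periodic_rep f hper x
  rw [← hxy]
  rw [integral_eq_zero_iff_of_nonneg h0 (torusBox_integrableOn hf)] at hint
  exact Measure.eqOn_of_ae_eq hint hf.continuousOn continuousOn_const (torusBox_closure d) hy

lemma torusBox_const {d : ℕ} (c : ℝ) (h : ∫ _ in torusBox d, c = 0) : c = 0 := by
  rw [setIntegral_const, smul_eq_mul, mul_eq_zero] at h
  refine h.resolve_left ?_
  rw [Measure.real, ← ne_eq, ENNReal.toReal_ne_zero]
  refine ⟨?_, (torusBox_isCompact d).measure_lt_top.ne⟩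
  exact (Measure.measure_pos_of_nonempty_interior _ (torusBox_interior_nonempty d)).ne'

/-- Partial derivative on `ℝ^d`. -/
noncomputable def Dp {d : ℕ} (η : EuclideanSpace ℝ (Fin d) → ℝ) (i : Fin d)
    (x : EuclideanSpace ℝ (Fin d)) : ℝ := fderiv ℝ η x (EuclideanSpace.single i 1)

/-- The area element. -/
noncomputable def Wp {d : ℕ} (η : EuclideanSpace ℝ (Fin d) → ℝ)
    (x : EuclideanSpace ℝ (Fin d)) : ℝ := Real.sqrt (1 + ∑ i, Dp η i x ^ 2)

/-- Periodicity with respect to the lattice. -/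
def Per {d : ℕ} (f : EuclideanSpace ℝ (Fin d) → ℝ) : Prop :=
  ∀ (x : EuclideanSpace ℝ (Fin d)) (i : Fin d),
      f (x + (2 * π) • EuclideanSpace.single i 1) = f x

lemma gradient_coord {d : ℕ} (η : EuclideanSpace ℝ (Fin d) → ℝ)
    (x : EuclideanSpace ℝ (Fin d)) (i : Fin d) : gradient η x i = Dp η i x := by
  have h : inner ℝ (gradient η x) (EuclideanSpace.single i (1:ℝ)) = _ :=
    inner_gradient_left
  rw [Dp, ← h]
  rw [EuclideanSpace.inner_single_right]
  simp

lemma Wp_eq {d : ℕ} (η : EuclideanSpace ℝ (Fin d) → ℝ) (x : EuclideanSpace ℝ (Fin d)) :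
    Real.sqrt (1 + ‖gradient η x‖ ^ 2) = Wp η x := by
  rw [Wp, EuclideanSpace.norm_sq_eq]
  simp [gradient_coord]

lemma Wp_pos {d : ℕ} (η : EuclideanSpace ℝ (Fin d) → ℝ) (x : EuclideanSpace ℝ (Fin d)) :
    0 < Wp η x := by
  apply Real.sqrt_pos.2
  have : 0 ≤ ∑ i, Dp η i x ^ 2 := Finset.sum_nonneg fun i _ => sq_nonneg _
  linarith

lemma Wp_sq {d : ℕ} (η : EuclideanSpace ℝ (Fin d) → ℝ) (x : EuclideanSpace ℝ (Fin d)) :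
    Wp η x ^ 2 = 1 + ∑ i, Dp η i x ^ 2 := by
  apply Real.sq_sqrt
  have : 0 ≤ ∑ i, Dp η i x ^ 2 := Finset.sum_nonneg fun i _ => sq_nonneg _
  linarith

lemma meanCurv_eq {d : ℕ} (η : EuclideanSpace ℝ (Fin d) → ℝ) (x : EuclideanSpace ℝ (Fin d)) :
    meanCurv η x = -∑ i, Dp (fun y => (Wp η y)⁻¹ * Dp η i y) i x := by
  simp only [meanCurv, Wp_eq, gradient_coord]
  rfl

lemma Dp_contDiff {d : ℕ} {η : EuclideanSpace ℝ (Fin d) → ℝ} (hη : ContDiff ℝ 2 η) (i : Fin d) :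
    ContDiff ℝ 1 (Dp η i) :=
  (hη.fderiv_right (m := 1) (by norm_num)).clm_apply contDiff_const

lemma Dp_continuous {d : ℕ} {η : EuclideanSpace ℝ (Fin d) → ℝ} (hη : ContDiff ℝ 1 η) (i : Fin d) :
    Continuous (Dp η i) :=
  (hη.continuous_fderiv (by norm_num)).clm_apply continuous_const

lemma Wp_contDiff {d : ℕ} {η : EuclideanSpace ℝ (Fin d) → ℝ} (hη : ContDiff ℝ 2 η) :
    ContDiff ℝ 1 (Wp η) := by
  apply ContDiff.sqrt
  · exact contDiff_const.add (ContDiff.sum fun i _ => (Dp_contDiff hη i).pow 2)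
  · intro x
    have : 0 ≤ ∑ i, Dp η i x ^ 2 := Finset.sum_nonneg fun i _ => sq_nonneg _
    linarith

lemma Dp_per {d : ℕ} {η : EuclideanSpace ℝ (Fin d) → ℝ} (hη : Per η) (i : Fin d) :
    Per (Dp η i) := by
  intro x j
  have h : (fun y => η (y + (2 * π) • EuclideanSpace.single j 1)) = η := funext fun y => hη y j
  have h2 := fderiv_comp_add_right (𝕜 := ℝ) (f := η) (x := x)
    ((2 * π) • EuclideanSpace.single j 1)
  rw [h] at h2
  rw [Dp, Dp, ← h2]

lemma Wp_per {d : ℕ} {η : EuclideanSpace ℝ (Fin d) → ℝ} (hη : Per η) : Per (Wp η) := by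
  intro x j
  simp only [Wp]
  congr 2
  exact Finset.sum_congr rfl fun i _ => by rw [Dp_per hη i x j]

lemma F_contDiff {d : ℕ} {η : EuclideanSpace ℝ (Fin d) → ℝ} (hη : ContDiff ℝ 2 η) (i : Fin d) :
    ContDiff ℝ 1 (fun y => (Wp η y)⁻¹ * Dp η i y) :=
  ((Wp_contDiff hη).inv fun x => (Wp_pos η x).ne').mul (Dp_contDiff hη i)

lemma F_per {d : ℕ} {η : EuclideanSpace ℝ (Fin d) → ℝ} (hη : Per η) (i : Fin d) :
    Per (fun y => (Wp η y)⁻¹ * Dp η i y) := by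
  intro x j
  simp only [Wp_per hη x j, Dp_per hη i x j]

lemma Dp_mul {d : ℕ} {f k : EuclideanSpace ℝ (Fin d) → ℝ} (hf : ContDiff ℝ 1 f)
    (hk : ContDiff ℝ 1 k) (i : Fin d) (x : EuclideanSpace ℝ (Fin d)) :
    Dp (fun y => f y * k y) i x = f x * Dp k i x + k x * Dp f i x := by
  have := ((hf.differentiable (by norm_num) x).hasFDerivAt.mul
    (hk.differentiable (by norm_num) x).hasFDerivAt).fderiv
  rw [Dp, show (fun y => f y * k y) = f * k from rfl, this]
  simp [Dp]

lemma meanCurv_continuous {d : ℕ} {η : EuclideanSpace ℝ (Fin d) → ℝ} (hη : ContDiff ℝ 2 η) :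
    Continuous (meanCurv η) := by
  have : meanCurv η = fun x => -∑ i, Dp (fun y => (Wp η y)⁻¹ * Dp η i y) i x :=
    funext (meanCurv_eq η)
  rw [this]
  exact (continuous_finsetSum _ fun i _ => Dp_continuous (F_contDiff hη i) i).neg

lemma meanCurv_integral {d : ℕ} {η φ : EuclideanSpace ℝ (Fin d) → ℝ} (hη : ContDiff ℝ 2 η)
    (hper : Per η) (hφ : ContDiff ℝ 1 φ) (hφper : Per φ) :
    ∫ x in torusBox d, meanCurv η x * φ x =
      ∫ x in torusBox d, ∑ i, (Wp η x)⁻¹ * Dp η i x * Dp φ i x := by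
  have hC : ∀ i, ContDiff ℝ 1 (fun y => (Wp η y)⁻¹ * Dp η i y * φ y) :=
    fun i => (F_contDiff hη i).mul hφ
  have key : ∀ x, meanCurv η x * φ x = ∑ i, (Wp η x)⁻¹ * Dp η i x * Dp φ i x -
      ∑ i, Dp (fun y => (Wp η y)⁻¹ * Dp η i y * φ y) i x := by
    intro x
    rw [meanCurv_eq, ← Finset.sum_sub_distrib, neg_mul, Finset.sum_mul, ← Finset.sum_neg_distrib]
    refine Finset.sum_congr rfl fun i _ => ?_
    rw [Dp_mul (F_contDiff hη i) hφ]
    ring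
  simp only [key]
  rw [integral_sub]
  · rw [integral_finsetSum (f := fun i x => Dp (fun y => (Wp η y)⁻¹ * Dp η i y * φ y) i x)]
    · rw [Finset.sum_eq_zero, sub_zero]
      intro i _
      refine integral_partial _ (hC i) i fun x => ?_
      simp only [Wp_per hper x i, Dp_per hper i x i, hφper x i]
    · intro i _
      exact torusBox_integrableOn (Dp_continuous (hC i) i)
  · exact torusBox_integrableOn (continuous_finsetSum _ fun i _ =>
      (F_contDiff hη i).continuous.mul (Dp_continuous hφ i))
  · exact torusBox_integrableOn (continuous_finsetSum _ fun i _ => Dp_continuous (hC i) i)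

lemma Dp_symm {d : ℕ} {η : EuclideanSpace ℝ (Fin d) → ℝ} (hη : ContDiff ℝ 2 η) (i j : Fin d)
    (x : EuclideanSpace ℝ (Fin d)) : Dp (Dp η i) j x = Dp (Dp η j) i x := by
  have hd : DifferentiableAt ℝ (fderiv ℝ η) x :=
    (hη.fderiv_right (m := 1) (by norm_num)).differentiable (by norm_num) x
  have h : ∀ i j, Dp (Dp η i) j x =
      fderiv ℝ (fderiv ℝ η) x (EuclideanSpace.single j 1) (EuclideanSpace.single i 1) := by
    intro i j
    have h1 := (hd.hasFDerivAt.clm_apply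
      (hasFDerivAt_const (EuclideanSpace.single i (1:ℝ)) x)).fderiv
    unfold Dp
    rw [h1]
    simp
  rw [h, h]
  exact (hη.contDiffAt.isSymmSndFDerivAt (by simp)).eq _ _

lemma Dp_Wp {d : ℕ} {η : EuclideanSpace ℝ (Fin d) → ℝ} (hη : ContDiff ℝ 2 η) (k : Fin d)
    (x : EuclideanSpace ℝ (Fin d)) :
    ∑ i, (Wp η x)⁻¹ * Dp η i x * Dp (Dp η k) i x = Dp (Wp η) k x := by
  have h1 : Dp (fun y => Wp η y * Wp η y) k x = 2 * Wp η x * Dp (Wp η) k x := by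
    rw [Dp_mul (Wp_contDiff hη) (Wp_contDiff hη)]; ring
  have h2 : (fun y => Wp η y * Wp η y) = fun y => 1 + ∑ i, Dp η i y * Dp η i y := by
    ext y; rw [← sq, Wp_sq]; simp [sq]
  have h3 : Dp (fun y => 1 + ∑ i, Dp η i y * Dp η i y) k x =
      ∑ i, Dp (fun y => Dp η i y * Dp η i y) k x := by
    unfold Dp
    rw [fderiv_const_add, fderiv_fun_sum]
    · simp
    · intro i _
      exact ((Dp_contDiff hη i).mul (Dp_contDiff hη i)).differentiable (by norm_num) x
  rw [h2, h3] at h1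
  simp only [Dp_mul (Dp_contDiff hη _) (Dp_contDiff hη _)] at h1
  have hW := (Wp_pos η x).ne'
  have h4 : Dp (Wp η) k x = (Wp η x)⁻¹ * (∑ i, (Dp η i x * Dp (Dp η i) k x)) := by
    have : (∑ i, (Dp η i x * Dp (Dp η i) k x)) = Wp η x * Dp (Wp η) k x := by
      have h5 : (∑ i, (Dp η i x * Dp (Dp η i) k x + Dp η i x * Dp (Dp η i) k x)) =
        2 * ∑ i, (Dp η i x * Dp (Dp η i) k x) := by
        rw [Finset.mul_sum]; exact Finset.sum_congr rfl fun i _ => by ring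
      linarith
    rw [this]; field_simp
  rw [h4, Finset.mul_sum]
  exact Finset.sum_congr rfl fun i _ => by rw [Dp_symm hη k i]; ring

lemma forcing_integral {d : ℕ} {η : EuclideanSpace ℝ (Fin d) → ℝ} (hη : ContDiff ℝ 2 η)
    (hper : Per η) (σ g : ℝ) (k : Fin d) :
    ∫ x in torusBox d, (σ * meanCurv η x + g * η x) * Dp η k x = 0 := by
  have hη1 : ContDiff ℝ 1 η := hη.of_le (by norm_num)
  have h1 : ∫ x in torusBox d, meanCurv η x * Dp η k x = 0 := by
    rw [meanCurv_integral hη hper (Dp_contDiff hη k) (Dp_per hper k)]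
    simp only [Dp_Wp hη k]
    exact integral_partial _ (Wp_contDiff hη) k fun x => Wp_per hper x k
  have h2 : ∫ x in torusBox d, Dp (fun y => η y * η y) k x = 0 :=
    integral_partial _ (hη1.mul hη1) k fun x => by simp only [hper x k]
  have h3 : ∀ x, (σ * meanCurv η x + g * η x) * Dp η k x =
      σ * (meanCurv η x * Dp η k x) + (g / 2) * Dp (fun y => η y * η y) k x := by
    intro x; rw [Dp_mul hη1 hη1]; ring
  simp only [h3]
  rw [integral_add, integral_const_mul, integral_const_mul, h1, h2]
  · simp
  · exact torusBox_integrableOn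
      (((meanCurv_continuous hη).mul (Dp_continuous hη1 k)).const_mul σ)
  · exact torusBox_integrableOn ((Dp_continuous (hη1.mul hη1) k).const_mul _)

lemma Dp_zero_const {d : ℕ} {f : EuclideanSpace ℝ (Fin d) → ℝ} (hf : ContDiff ℝ 1 f)
    (h : ∀ i x, Dp f i x = 0) : ∀ x y, f x = f y := by
  apply is_const_of_fderiv_eq_zero (𝕜 := ℝ) (hf.differentiable (by norm_num))
  intro x
  apply ContinuousLinearMap.coe_injective
  apply (EuclideanSpace.basisFun (Fin d) ℝ).toBasis.ext
  intro i
  simpa [Dp] using h i x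

/-- Injectivity of `σH + g` on mean-zero functions, up to constants. -/
lemma curvature_injective {d : ℕ} {η : EuclideanSpace ℝ (Fin d) → ℝ} (hη : ContDiff ℝ 2 η)
    (hper : Per η) (hmean : ∫ x in torusBox d, η x = 0) {σ g : ℝ} (hσ : 0 < σ) (hg : 0 ≤ g)
    (hc : ∀ x y, σ * meanCurv η x + g * η x = σ * meanCurv η y + g * η y) :
    (∀ x, σ * meanCurv η x + g * η x = 0) ∧ ∀ x, η x = 0 := by
  have hη1 : ContDiff ℝ 1 η := hη.of_le (by norm_num)
  have hH : ∫ x in torusBox d, meanCurv η x = 0 := by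
    have := meanCurv_integral (φ := fun _ => 1) hη hper contDiff_const (fun _ _ => rfl)
    simpa [Dp] using this
  have hz : σ * meanCurv η 0 + g * η 0 = 0 := by
    apply torusBox_const (d := d)
    calc ∫ _ in torusBox d, (σ * meanCurv η 0 + g * η 0)
        = ∫ x in torusBox d, (σ * meanCurv η x + g * η x) := by
          congr 1; ext x; exact hc _ _
      _ = 0 := by
          rw [integral_add, integral_const_mul, integral_const_mul, hH, hmean]
          · simp
          · exact torusBox_integrableOn ((meanCurv_continuous hη).const_mul σ)
          · exact torusBox_integrableOn (hη.continuous.const_mul g)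
  have hall : ∀ x, σ * meanCurv η x + g * η x = 0 := fun x => (hc x 0).trans hz
  refine ⟨hall, ?_⟩
  have hE := meanCurv_integral hη hper hη1 hper
  set N : EuclideanSpace ℝ (Fin d) → ℝ := fun x => ∑ i, (Wp η x)⁻¹ * Dp η i x * Dp η i x with hN
  have hterm : ∀ x i, 0 ≤ (Wp η x)⁻¹ * Dp η i x * Dp η i x := fun x i => by
    rw [mul_assoc]
    exact mul_nonneg (inv_pos.2 (Wp_pos η x)).le (mul_self_nonneg _)
  have hNn : ∀ x, 0 ≤ N x := fun x => Finset.sum_nonneg fun i _ => hterm x i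
  have hNc : Continuous N := continuous_finsetSum _ fun i _ =>
      (F_contDiff hη i).continuous.mul (Dp_continuous hη1 i)
  have hNp : Per N := fun x j => by simp only [hN, Wp_per hper x j, Dp_per hper _ x j]
  have hN0 : ∫ x in torusBox d, N x = 0 := by
    apply le_antisymm _ (integral_nonneg hNn)
    rw [← hE]
    apply integral_nonpos
    intro x
    have h1 : σ * (meanCurv η x * η x) = - (g * (η x * η x)) := by
      linear_combination η x * hall x
    have h2 : 0 ≤ g * (η x * η x) := mul_nonneg hg (mul_self_nonneg _)
    by_contra hcon
    have h3 : 0 < meanCurv η x * η x := not_le.1 hcon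
    have := mul_pos hσ h3
    linarith
  have hN1 := periodic_zero N hNc hNp hNn hN0
  have hconst := Dp_zero_const hη1 (by
    intro i x
    have h1 := (Finset.sum_eq_zero_iff_of_nonneg (fun i _ => hterm x i)).1 (hN1 x) i
      (Finset.mem_univ i)
    have hW := (inv_pos.2 (Wp_pos η x)).ne'
    simpa [hW, (Wp_pos η x).ne'] using h1)
  intro x
  apply torusBox_const (d := d)
  rw [← hmean]
  congr 1
  ext y
  exact hconst _ _

lemma pdx_contDiff {d : ℕ} {q : EuclideanSpace ℝ (Fin d) × ℝ → ℝ}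
    (hq : ContDiff ℝ (⊤ : ℕ∞) q) (i : Fin d) : ContDiff ℝ (⊤ : ℕ∞) (pdx i q) :=
  (hq.fderiv_right (m := (⊤ : ℕ∞)) (by norm_cast)).clm_apply contDiff_const

lemma pdz_contDiff {d : ℕ} {q : EuclideanSpace ℝ (Fin d) × ℝ → ℝ}
    (hq : ContDiff ℝ (⊤ : ℕ∞) q) : ContDiff ℝ (⊤ : ℕ∞) (pdz q) :=
  (hq.fderiv_right (m := (⊤ : ℕ∞)) (by norm_cast)).clm_apply contDiff_const

lemma smooth_diff {d : ℕ} {q : EuclideanSpace ℝ (Fin d) × ℝ → ℝ}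
    (hq : ContDiff ℝ (⊤ : ℕ∞) q) : Differentiable ℝ q :=
  hq.differentiable (by simp)

lemma pdx_mul {d : ℕ} {f k : EuclideanSpace ℝ (Fin d) × ℝ → ℝ} (hf : ContDiff ℝ (⊤ : ℕ∞) f)
    (hk : ContDiff ℝ (⊤ : ℕ∞) k) (i : Fin d) (p : EuclideanSpace ℝ (Fin d) × ℝ) :
    pdx i (fun y => f y * k y) p = f p * pdx i k p + k p * pdx i f p := by
  have := ((smooth_diff hf p).hasFDerivAt.mul (smooth_diff hk p).hasFDerivAt).fderiv
  rw [pdx, show (fun y => f y * k y) = f * k from rfl, this]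
  simp [pdx]

lemma pdz_mul {d : ℕ} {f k : EuclideanSpace ℝ (Fin d) × ℝ → ℝ} (hf : ContDiff ℝ (⊤ : ℕ∞) f)
    (hk : ContDiff ℝ (⊤ : ℕ∞) k) (p : EuclideanSpace ℝ (Fin d) × ℝ) :
    pdz (fun y => f y * k y) p = f p * pdz k p + k p * pdz f p := by
  have := ((smooth_diff hf p).hasFDerivAt.mul (smooth_diff hk p).hasFDerivAt).fderiv
  rw [pdz, show (fun y => f y * k y) = f * k from rfl, this]
  simp [pdz]

lemma fderiv_split {d : ℕ} (q : EuclideanSpace ℝ (Fin d) × ℝ → ℝ)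
    (p : EuclideanSpace ℝ (Fin d) × ℝ) (v : EuclideanSpace ℝ (Fin d)) (w : ℝ) :
    fderiv ℝ q p (v, w) = ∑ i, v i * pdx i q p + w * pdz q p := by
  have hv : v = ∑ i, v i • (EuclideanSpace.single i 1 : EuclideanSpace ℝ (Fin d)) := by
    ext j
    simp [Finset.sum_apply, Pi.single_apply]
  have h1 : ((v, w) : EuclideanSpace ℝ (Fin d) × ℝ) =
      ContinuousLinearMap.inl ℝ _ ℝ v + w • ((0, 1) : EuclideanSpace ℝ (Fin d) × ℝ) := by
    simp
  rw [h1, map_add, map_smul, smul_eq_mul]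
  congr 1
  conv_lhs => rw [hv]
  rw [map_sum, map_sum]
  refine Finset.sum_congr rfl fun i _ => ?_
  rw [map_smul, map_smul, smul_eq_mul]
  rfl

lemma Dp_slice {d : ℕ} {k : EuclideanSpace ℝ (Fin d) × ℝ → ℝ} (hk : ContDiff ℝ (⊤ : ℕ∞) k)
    {η : EuclideanSpace ℝ (Fin d) → ℝ} (hη : ContDiff ℝ 1 η) (b s : ℝ) (i : Fin d)
    (x : EuclideanSpace ℝ (Fin d)) :
    Dp (fun y => k (y, -b + s * (η y + b))) i x =
      pdx i k (x, -b + s * (η x + b)) + s * Dp η i x * pdz k (x, -b + s * (η x + b)) := by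
  have h1 := (hη.differentiable (by norm_num) x).hasFDerivAt
  have h2 : HasFDerivAt (fun y => (y, -b + s * (η y + b)))
      ((ContinuousLinearMap.id ℝ _).prod (s • fderiv ℝ η x)) x :=
    (hasFDerivAt_id x).prodMk (((h1.add_const b).const_mul s).const_add (-b))
  have h3 := ((smooth_diff hk (x, -b + s * (η x + b))).hasFDerivAt.comp x h2).fderiv
  unfold Dp
  rw [show (fun y => k (y, -b + s * (η y + b))) = k ∘ fun y => (y, -b + s * (η y + b)) from rfl,
    h3]
  simp only [ContinuousLinearMap.comp_apply, ContinuousLinearMap.prod_apply, fderiv_split]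
  congr 1
  simp [Pi.single_apply]

lemma hasDerivAt_slice {d : ℕ} {k : EuclideanSpace ℝ (Fin d) × ℝ → ℝ}
    (hk : ContDiff ℝ (⊤ : ℕ∞) k) (x : EuclideanSpace ℝ (Fin d)) (b h s : ℝ) :
    HasDerivAt (fun s => k (x, -b + s * h)) (h * pdz k (x, -b + s * h)) s := by
  have h2 : HasDerivAt (fun s : ℝ => (x, -b + s * h)) ((0 : EuclideanSpace ℝ (Fin d)), h) s := by
    refine (hasDerivAt_const s x).prodMk ?_
    simpa using ((hasDerivAt_id s).mul_const h).const_add (-b)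
  have h3 := (smooth_diff hk (x, -b + s * h)).hasFDerivAt.comp_hasDerivAt s h2
  rw [fderiv_split] at h3
  have h4 : (∑ i, (0 : EuclideanSpace ℝ (Fin d)) i * pdx i k (x, -b + s * h) +
      h * pdz k (x, -b + s * h)) = h * pdz k (x, -b + s * h) := by simp
  rw [← h4]
  exact h3

lemma pdx_per {d : ℕ} {q : EuclideanSpace ℝ (Fin d) × ℝ → ℝ}
    (hqper : ∀ (x : EuclideanSpace ℝ (Fin d)) (z : ℝ) (i : Fin d),
      q (x + (2 * π) • EuclideanSpace.single i 1, z) = q (x, z))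
    (x : EuclideanSpace ℝ (Fin d)) (z : ℝ) (i : Fin d) :
    fderiv ℝ q (x + (2 * π) • EuclideanSpace.single i 1, z) = fderiv ℝ q (x, z) := by
  have h : (fun p => q (p + ((2 * π) • EuclideanSpace.single i 1, 0))) = q := by
    ext ⟨y, t⟩
    simpa using hqper y t i
  have h2 := fderiv_comp_add_right (𝕜 := ℝ) (f := q) (x := (x, z))
    ((2 * π) • EuclideanSpace.single i 1, 0)
  rw [h] at h2
  rw [h2]
  simp

/-- Squared gradient. -/
noncomputable def gradSq {d : ℕ} (q : EuclideanSpace ℝ (Fin d) × ℝ → ℝ)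
    (p : EuclideanSpace ℝ (Fin d) × ℝ) : ℝ := ∑ i, pdx i q p ^ 2 + pdz q p ^ 2

/-- Energy identity (Green's formula). -/
lemma energy {d : ℕ} {b : ℝ}
    {η : EuclideanSpace ℝ (Fin d) → ℝ} (hη : ContDiff ℝ 2 η) (hper : Per η)
    (hlow : ∀ x, 0 < η x + b)
    {q : EuclideanSpace ℝ (Fin d) × ℝ → ℝ} (hq : ContDiff ℝ (⊤ : ℕ∞) q)
    (hqper : ∀ (x : EuclideanSpace ℝ (Fin d)) (z : ℝ) (i : Fin d),
      q (x + (2 * π) • EuclideanSpace.single i 1, z) = q (x, z))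
    (hharm : ∀ p : EuclideanSpace ℝ (Fin d) × ℝ, -b < p.2 → p.2 < η p.1 →
      (∑ i : Fin d, pdx i (pdx i q) p) + pdz (pdz q) p = 0)
    (hneu : ∀ x, pdz q (x, -b) = 0) :
    ∫ x in torusBox d, q (x, η x) * fderiv ℝ q (x, η x) (-gradient η x, 1) =
      ∫ x in torusBox d, ∫ s in (0:ℝ)..1, (η x + b) * gradSq q (x, -b + s * (η x + b)) := by
  have hη1 : ContDiff ℝ 1 η := hη.of_le (by norm_num)
  have hqx := pdx_contDiff hq
  have hqz := pdz_contDiff hq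
  have hk : ∀ i, ContDiff ℝ (⊤ : ℕ∞) (fun p => q p * pdx i q p) := fun i => hq.mul (hqx i)
  have hl : ContDiff ℝ (⊤ : ℕ∞) (fun p => q p * pdz q p) := hq.mul hqz
  have hηc := hη.continuous
  have hDc := Dp_continuous hη1
  -- the flattened divergence
  set A : ℝ → EuclideanSpace ℝ (Fin d) → ℝ := fun s x =>
    ∑ i, Dp (fun y => (η y + b) * (fun p => q p * pdx i q p) (y, -b + s * (η y + b))) i x with hA
  set B : ℝ → EuclideanSpace ℝ (Fin d) → ℝ := fun s x =>
    (η x + b) * gradSq q (x, -b + s * (η x + b)) with hB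
  have hh1 : ContDiff ℝ 1 (fun y => η y + b) := hη1.add contDiff_const
  have hDh : ∀ i x, Dp (fun y => η y + b) i x = Dp η i x := by
    intro i x; simp [Dp, fderiv_add_const]
  have hslice1 : ∀ {k : EuclideanSpace ℝ (Fin d) × ℝ → ℝ}, ContDiff ℝ (⊤ : ℕ∞) k → ∀ s : ℝ,
      ContDiff ℝ 1 (fun y => k (y, -b + s * (η y + b))) := by
    intro k hk s
    exact (hk.of_le (by exact_mod_cast le_top)).comp
      (contDiff_id.prodMk (contDiff_const.add (contDiff_const.mul hh1)))
  have hAeq : ∀ s x, A s x = ∑ i, ((η x + b) *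
      (pdx i (fun p => q p * pdx i q p) (x, -b + s * (η x + b)) +
        s * Dp η i x * pdz (fun p => q p * pdx i q p) (x, -b + s * (η x + b))) +
      (q (x, -b + s * (η x + b)) * pdx i q (x, -b + s * (η x + b))) * Dp η i x) := by
    intro s x
    simp only [hA]
    refine Finset.sum_congr rfl fun i _ => ?_
    rw [Dp_mul hh1 (hslice1 (hk i) s), Dp_slice (hk i) hη1, hDh]
  have hqc := hq.continuous
  have hqxc := fun i => (hqx i).continuous
  have hqzc := hqz.continuous
  have hkx := fun i => (pdx_contDiff (hk i) i).continuous
  have hkz := fun i => (pdz_contDiff (hk i)).continuous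
  have hAc : Continuous (Function.uncurry A) := by
    have : Function.uncurry A = fun p => _ := funext fun p => hAeq p.1 p.2
    rw [this]
    fun_prop
  have hBc : Continuous (Function.uncurry B) := by
    simp only [hB, gradSq, Function.uncurry_def]
    fun_prop
  -- integral of A over the cell vanishes for each s
  have hA0 : ∀ s, ∫ x in torusBox d, A s x = 0 := by
    intro s
    simp only [hA]
    rw [integral_finsetSum]
    · refine Finset.sum_eq_zero fun i _ => ?_
      refine integral_partial _ (hh1.mul (hslice1 (hk i) s)) i fun x => ?_
      simp only [hper x i, hqper, pdx, pdx_per hqper]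
    · intro i _
      exact torusBox_integrableOn (Dp_continuous (hh1.mul (hslice1 (hk i) s)) i)
  have hswap : ∫ x in torusBox d, ∫ s in (0:ℝ)..1, A s x = 0 := by
    rw [← intervalIntegral_integral_swap]
    · simp [hA0]
    · rw [Measure.prod_restrict]
      refine IntegrableOn.mono_set (hAc.continuousOn.integrableOn_compact
        ((isCompact_Icc (a := (0:ℝ)) (b := 1)).prod (torusBox_isCompact d))) ?_
      apply Set.prod_mono_left
      rw [Set.uIoc_of_le zero_le_one]
      exact Set.Ioc_subset_Icc_self
  -- vertical integration
  have hvert : ∀ x, ∫ s in (0:ℝ)..1, (A s x - B s x) =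
      -(q (x, η x) * fderiv ℝ q (x, η x) (-gradient η x, 1)) := by
    intro x
    set T : ℝ → ℝ := fun s => ∑ i, s * Dp η i x * (fun p => q p * pdx i q p)
      (x, -b + s * (η x + b)) - (fun p => q p * pdz q p) (x, -b + s * (η x + b)) with hT
    have hTc : Continuous T := by
      simp only [hT]
      fun_prop
    have hTd : ∀ s ∈ Set.Ioo (0:ℝ) 1, HasDerivAt T (A s x - B s x) s := by
      intro s hs
      have h1 : HasDerivAt T (∑ i, (Dp η i x * (fun p => q p * pdx i q p)
          (x, -b + s * (η x + b)) + s * Dp η i x * ((η x + b) *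
            pdz (fun p => q p * pdx i q p) (x, -b + s * (η x + b)))) -
          (η x + b) * pdz (fun p => q p * pdz q p) (x, -b + s * (η x + b))) s := by
        refine HasDerivAt.sub ?_ (hasDerivAt_slice hl x b _ s)
        refine HasDerivAt.fun_sum fun i _ => ?_
        refine HasDerivAt.mul ?_ (hasDerivAt_slice (hk i) x b _ s)
        simpa using (hasDerivAt_id s).mul_const (Dp η i x)
      convert h1 using 1
      have hpos := hlow x
      have hh := hharm (x, -b + s * (η x + b))
        (by simpa using mul_pos hs.1 hpos)
        (by
          have := mul_lt_mul_of_pos_right hs.2 hpos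
          simp only
          linarith)
      rw [hAeq]
      simp only [hB, gradSq, pdx_mul hq (hqx _), pdz_mul hq hqz]
      generalize hp : (x, -b + s * (η x + b)) = p at *
      have hsum : ∑ i, ((η x + b) * (q p * pdx i (pdx i q) p + pdx i q p * pdx i q p +
          s * Dp η i x * pdz (fun p => q p * pdx i q p) p) + q p * pdx i q p * Dp η i x) =
          ∑ i, (Dp η i x * (q p * pdx i q p) + s * Dp η i x * ((η x + b) *
            pdz (fun p => q p * pdx i q p) p)) +
          (η x + b) * q p * ∑ i, pdx i (pdx i q) p + (η x + b) * ∑ i, pdx i q p ^ 2 := by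
        rw [Finset.mul_sum, Finset.mul_sum, ← Finset.sum_add_distrib, ← Finset.sum_add_distrib]
        exact Finset.sum_congr rfl fun i _ => by ring
      rw [hsum]
      linear_combination (η x + b) * q p * hh
    have hAs : Continuous fun s => A s x := hAc.comp (continuous_id.prodMk continuous_const)
    have hBs : Continuous fun s => B s x := hBc.comp (continuous_id.prodMk continuous_const)
    rw [intervalIntegral.integral_eq_sub_of_hasDerivAt_of_le zero_le_one hTc.continuousOn hTd
      ((hAs.sub hBs).intervalIntegrable _ _)]
    have e1 : -b + (η x + b) = η x := by ring
    simp only [hT, one_mul, zero_mul, Finset.sum_const_zero, e1, add_zero, hneu, fderiv_split,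
      mul_zero, sub_zero, PiLp.neg_apply, gradient_coord]
    rw [mul_add, Finset.mul_sum, neg_add, ← Finset.sum_neg_distrib, sub_eq_add_neg]
    congr 1
    exact Finset.sum_congr rfl fun i _ => by ring
  have hcA : Continuous fun x => ∫ s in (0:ℝ)..1, A s x :=
    intervalIntegral.continuous_parametric_intervalIntegral_of_continuous'
      (f := fun x s => A s x) (hAc.comp continuous_swap) 0 1
  have hcB : Continuous fun x => ∫ s in (0:ℝ)..1, B s x :=
    intervalIntegral.continuous_parametric_intervalIntegral_of_continuous'
      (f := fun x s => B s x) (hBc.comp continuous_swap) 0 1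
  have hfin : ∫ x in torusBox d, -(q (x, η x) * fderiv ℝ q (x, η x) (-gradient η x, 1)) =
      -∫ x in torusBox d, ∫ s in (0:ℝ)..1, B s x := by
    have hsub := integral_sub (torusBox_integrableOn hcA) (torusBox_integrableOn hcB)
    rw [hswap, zero_sub] at hsub
    rw [← hsub]
    congr 1
    ext x
    rw [← hvert, intervalIntegral.integral_sub]
    · exact (hAc.comp (continuous_id.prodMk continuous_const)).intervalIntegrable _ _
    · exact (hBc.comp (continuous_id.prodMk continuous_const)).intervalIntegrable _ _
  rw [integral_neg] at hfin
  exact neg_injective hfin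

lemma gradSq_nonneg {d : ℕ} (q : EuclideanSpace ℝ (Fin d) × ℝ → ℝ)
    (p : EuclideanSpace ℝ (Fin d) × ℝ) : 0 ≤ gradSq q p :=
  add_nonneg (Finset.sum_nonneg fun _ _ => sq_nonneg _) (sq_nonneg _)

/-- Rigidity: if a mean-zero periodic `η ∈ C²` solves the traveling wave equation
`-γ∂₁η = -G[η](σH(η) + gη)` with no external pressure, where `G[η]` is realized by the
harmonic extension `q` of `σH(η) + gη` to `Ω_η` with Neumann bottom condition, then
`∫ (σH(η)+gη)·G[η](σH(η)+gη) = 0`, hence `σH(η) + gη = 0` and `η = 0`. -/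
theorem stmt_17 (d : ℕ) (hd : 0 < d) (b c0 σ g γ : ℝ)
    (hσ : 0 < σ) (hg : 0 ≤ g) (hb : 0 < b) (hc0 : 0 < c0)
    (η : EuclideanSpace ℝ (Fin d) → ℝ) (hη : ContDiff ℝ 2 η)
    (hηper : ∀ (x : EuclideanSpace ℝ (Fin d)) (i : Fin d),
      η (x + (2 * π) • EuclideanSpace.single i 1) = η x)
    (hηmean : ∫ x in torusBox d, η x = 0)
    (hlow : ∀ x, c0 ≤ η x + b)
    (q : EuclideanSpace ℝ (Fin d) × ℝ → ℝ) (hq : ContDiff ℝ (⊤ : ℕ∞) q)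
    (hqper : ∀ (x : EuclideanSpace ℝ (Fin d)) (z : ℝ) (i : Fin d),
      q (x + (2 * π) • EuclideanSpace.single i 1, z) = q (x, z))
    (hharm : ∀ p : EuclideanSpace ℝ (Fin d) × ℝ, -b < p.2 → p.2 < η p.1 →
      (∑ i : Fin d, pdx i (pdx i q) p) + pdz (pdz q) p = 0)
    (hdir : ∀ x, q (x, η x) = σ * meanCurv η x + g * η x)
    (hneu : ∀ x, pdz q (x, -b) = 0)
    (heq : ∀ x, -γ * fderiv ℝ η x (EuclideanSpace.single ⟨0, hd⟩ 1) =
      -(fderiv ℝ q (x, η x) (-gradient η x, 1))) :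
    (∫ x in torusBox d,
        (σ * meanCurv η x + g * η x) * fderiv ℝ q (x, η x) (-gradient η x, 1)) = 0 ∧
    (∀ x, σ * meanCurv η x + g * η x = 0) ∧
    (∀ x, η x = 0) := by
  have hη1 : ContDiff ℝ 1 η := hη.of_le (by norm_num)
  have hpos : ∀ x, 0 < η x + b := fun x => hc0.trans_le (hlow x)
  have hG : ∀ x, fderiv ℝ q (x, η x) (-gradient η x, 1) = γ * Dp η ⟨0, hd⟩ x := by
    intro x
    have := heq x
    simp only [Dp]
    linarith
  have hI : (∫ x in torusBox d,
      (σ * meanCurv η x + g * η x) * fderiv ℝ q (x, η x) (-gradient η x, 1)) = 0 := by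
    have h1 : ∀ x, (σ * meanCurv η x + g * η x) * fderiv ℝ q (x, η x) (-gradient η x, 1) =
        γ * ((σ * meanCurv η x + g * η x) * Dp η ⟨0, hd⟩ x) := by
      intro x; rw [hG]; ring
    simp only [h1]
    rw [integral_const_mul, forcing_integral hη hηper, mul_zero]
  refine ⟨hI, ?_⟩
  apply curvature_injective hη hηper hηmean hσ hg
  have hE := energy hη hηper hpos hq hqper hharm hneu
  simp only [hdir, hI] at hE
  have hgc : Continuous (gradSq q) :=
    (continuous_finsetSum _ fun i _ => (pdx_contDiff hq i).continuous.pow 2).add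
      ((pdz_contDiff hq).continuous.pow 2)
  have hηc := hη.continuous
  have hBc : Continuous (Function.uncurry fun (x : EuclideanSpace ℝ (Fin d)) (s : ℝ) =>
      (η x + b) * gradSq q (x, -b + s * (η x + b))) := by
    simp only [Function.uncurry_def]
    fun_prop
  have hterm : ∀ x s, 0 ≤ (η x + b) * gradSq q (x, -b + s * (η x + b)) := fun x s =>
    mul_nonneg (hpos x).le (gradSq_nonneg _ _)
  have hP := periodic_zero (fun x => ∫ s in (0:ℝ)..1,
      (η x + b) * gradSq q (x, -b + s * (η x + b)))
    (intervalIntegral.continuous_parametric_intervalIntegral_of_continuous' hBc 0 1)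
    (by
      intro x i
      simp only [hηper x i, gradSq, pdx, pdz, pdx_per hqper])
    (fun x => intervalIntegral.integral_nonneg zero_le_one fun s _ => hterm x s)
    hE.symm
  have hgrad : ∀ x, gradSq q (x, η x) = 0 := by
    intro x
    have hc : Continuous fun s : ℝ => (η x + b) * gradSq q (x, -b + s * (η x + b)) := by
      fun_prop
    have h1 := hP x
    rw [intervalIntegral.integral_of_le zero_le_one, ← integral_Icc_eq_integral_Ioc,
      integral_eq_zero_iff_of_nonneg (fun s => hterm x s)
        (hc.continuousOn.integrableOn_compact isCompact_Icc)] at h1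
    have h2 := Measure.eqOn_Icc_of_ae_eq volume zero_ne_one h1 hc.continuousOn
      continuousOn_const (Set.right_mem_Icc.2 zero_le_one)
    have e1 : -b + 1 * (η x + b) = η x := by ring
    simp only [e1, Pi.zero_apply] at h2
    exact (mul_eq_zero.1 h2).resolve_left (hpos x).ne'
  have hQ : ∀ x, q (x, η x) = (fun y => q (y, -b + 1 * (η y + b))) x := by
    intro x; simp
  intro x y
  rw [← hdir, ← hdir, hQ x, hQ y]
  refine Dp_zero_const (f := fun y => q (y, -b + 1 * (η y + b))) ?_ ?_ x y
  · exact (hq.of_le (by exact_mod_cast le_top)).comp (contDiff_id.prodMk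
      (contDiff_const.add (contDiff_const.mul (hη1.add contDiff_const))))
  · intro i x
    rw [Dp_slice hq hη1]
    have e1 : -b + 1 * (η x + b) = η x := by ring
    rw [e1]
    have h0 := hgrad x
    have hs : 0 ≤ ∑ i, pdx i q (x, η x) ^ 2 := Finset.sum_nonneg fun _ _ => sq_nonneg _
    have hz : pdz q (x, η x) ^ 2 = 0 := by
      rw [gradSq] at h0
      exact le_antisymm (by linarith) (sq_nonneg _)
    have hx : ∑ i, pdx i q (x, η x) ^ 2 = 0 := by
      rw [gradSq] at h0
      linarith
    have hxi := (Finset.sum_eq_zero_iff_of_nonneg (fun i _ => sq_nonneg _)).1 hx i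
      (Finset.mem_univ i)
    rw [pow_eq_zero_iff two_ne_zero] at hz hxi
    rw [hz, hxi]
    simp
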